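/- For every dimension d ≥ 1 there exists a constant c_d > 0 (depending only on d) such that for every integer N ≥ 2 and every set P of N points in [0,1]^d there exists a coloring y : P → {−1, +1} such that for every axis-parallel box A = ∏_{i=1}^d [0, a_i] ⊆ [0,1]^d with one vertex at the origin, |∑_{p ∈ P ∩ A} y(p)| ≤ c_d (log N)^{d − 1/2}. -/

import Mathlib

section

open MeasureTheory ProbabilityTheory Set
open scoped ENNReal NNReal Pointwise

theorem volume_add_volume_le_of_isCompact {A B C : Set ℝ} (hA : IsCompact A) (hB : IsCompact B)
    (hA' : A.Nonempty) (hB' : B.Nonempty) (h : ∀ x ∈ A, ∀ y ∈ B, (x + y) / 2 ∈ C) :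
    volume A + volume B ≤ 2 * volume C := by
  obtain ⟨a, ha, hamax⟩ := hA.exists_isGreatest hA'
  obtain ⟨b, hb, hbmin⟩ := hB.exists_isLeast hB'
  have hsub : (b +ᵥ A) ∪ (a +ᵥ B) ⊆ (2 : ℝ) • C := by
    rintro z (⟨x, hx, rfl⟩ | ⟨x, hx, rfl⟩)
    · exact ⟨(x + b) / 2, h x hx b hb, by simp [vadd_eq_add]; ring⟩
    · exact ⟨(a + x) / 2, h a ha x hx, by simp [vadd_eq_add]; ring⟩
  have hinter : volume ((b +ᵥ A) ∩ (a +ᵥ B)) = 0 := by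
    refine measure_mono_null (t := {a + b}) ?_ (by simp)
    rintro z ⟨⟨x, hx, rfl⟩, ⟨y, hy, hxy⟩⟩
    have h1 := hamax hx
    have h2 := hbmin hy
    simp only [vadd_eq_add, mem_singleton_iff] at hxy ⊢
    linarith
  have hmeas : MeasurableSet (a +ᵥ B) := (hB.vadd a).measurableSet
  calc volume A + volume B = volume (b +ᵥ A) + volume (a +ᵥ B) := by simp
    _ = volume ((b +ᵥ A) ∪ (a +ᵥ B)) := by
        rw [← measure_union_add_inter _ hmeas, hinter, add_zero]
    _ ≤ volume ((2 : ℝ) • C) := measure_mono hsub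
    _ = 2 * volume C := by
        rw [Measure.addHaar_smul]; simp

/-- The one-dimensional Brunn–Minkowski inequality. -/
theorem volume_add_volume_le {A B C : Set ℝ} (hA : MeasurableSet A) (hB : MeasurableSet B)
    (hA' : A.Nonempty) (hB' : B.Nonempty) (h : ∀ x ∈ A, ∀ y ∈ B, (x + y) / 2 ∈ C) :
    volume A + volume B ≤ 2 * volume C := by
  obtain ⟨a, ha⟩ := hA'
  obtain ⟨b, hb⟩ := hB'
  have key : ∀ K ⊆ A, IsCompact K → volume K + volume B ≤ 2 * volume C := by
    intro K hK hKc
    have hK' : volume (insert a K) ≠ ∞ := (hKc.insert a).measure_lt_top.ne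
    have hB2 : volume B ≤ 2 * volume C - volume (insert a K) := by
      rw [hB.measure_eq_iSup_isCompact]
      refine iSup₂_le fun L hL => iSup_le fun hLc => ?_
      refine (measure_mono (subset_insert b L)).trans (ENNReal.le_sub_of_add_le_left hK' ?_)
      exact volume_add_volume_le_of_isCompact (hKc.insert a) (hLc.insert b) ⟨a, by simp⟩
        ⟨b, by simp⟩ fun x hx y hy => h x (insert_subset ha hK hx) y (insert_subset hb hL hy)
    by_cases hfin : volume (insert a K) ≤ 2 * volume C
    · calc volume K + volume B ≤ volume (insert a K) + (2 * volume C - volume (insert a K)) :=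
            add_le_add (measure_mono (subset_insert a K)) hB2
        _ = _ := add_tsub_cancel_of_le hfin
    · refine absurd ?_ hfin
      have := volume_add_volume_le_of_isCompact (hKc.insert a) (isCompact_singleton (x := b))
        ⟨a, by simp⟩ ⟨b, by simp⟩ fun x hx y hy =>
          h x (insert_subset ha hK hx) y (by rw [mem_singleton_iff.1 hy]; exact hb)
      simpa using this
  by_cases hBt : volume B = ∞
  · have := key ∅ (empty_subset _) isCompact_empty
    simp only [measure_empty, zero_add, hBt, top_le_iff] at this
    simp [this]
  · have hA2 : volume A ≤ 2 * volume C - volume B := by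
      rw [hA.measure_eq_iSup_isCompact]
      exact iSup₂_le fun K hK => iSup_le fun hKc =>
        ENNReal.le_sub_of_add_le_right hBt (key K hK hKc)
    have h0 := key ∅ (empty_subset _) isCompact_empty
    simp only [measure_empty, zero_add] at h0
    calc volume A + volume B ≤ (2 * volume C - volume B) + volume B := by gcongr
      _ = _ := tsub_add_cancel_of_le h0

theorem lintegral_add_lintegral_le_of_sup_eq_one {f g h : ℝ → ℝ} (hf : Measurable f)
    (hg : Measurable g) (hh : Measurable h) (hf0 : 0 ≤ f) (hg0 : 0 ≤ g) (hh0 : 0 ≤ h)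
    (hf1 : ∀ x, f x ≤ 1) (hg1 : ∀ x, g x ≤ 1) (hfs : ∀ t < 1, ∃ x, t < f x)
    (hgs : ∀ t < 1, ∃ x, t < g x) (H : ∀ x y, f x * g y ≤ h ((x + y) / 2) ^ 2) :
    (∫⁻ x, ENNReal.ofReal (f x)) + ∫⁻ x, ENNReal.ofReal (g x)
      ≤ 2 * ∫⁻ x, ENNReal.ofReal (h x) := by
  rw [lintegral_eq_lintegral_meas_lt _ (.of_forall hf0) hf.aemeasurable,
    lintegral_eq_lintegral_meas_lt _ (.of_forall hg0) hg.aemeasurable,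
    lintegral_eq_lintegral_meas_lt _ (.of_forall hh0) hh.aemeasurable,
    ← lintegral_const_mul' _ _ (by simp), ← lintegral_add_left]
  · refine setLIntegral_mono' measurableSet_Ioi fun t ht => ?_
    by_cases ht1 : t < 1
    · refine volume_add_volume_le (hf measurableSet_Ioi) (hg measurableSet_Ioi) (hfs t ht1)
        (hgs t ht1) fun x hx y hy => ?_
      simp only [mem_Ioi, mem_ofPred_eq] at hx hy ht ⊢
      have h1 : t * t < f x * g y := mul_lt_mul'' hx hy ht.le ht.le
      have h2 := H x y
      exact lt_of_pow_lt_pow_left₀ 2 (hh0 _) (by nlinarith)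
    · have e1 : {a | t < f a} = ∅ := by
        ext x; simpa using (hf1 x).trans (not_lt.1 ht1)
      have e2 : {a | t < g a} = ∅ := by
        ext x; simpa using (hg1 x).trans (not_lt.1 ht1)
      simp [e1, e2]
  · exact (Antitone.measurable fun s t hst => measure_mono fun x hx => lt_of_le_of_lt hst hx)

theorem integral_mul_integral_le_sq_of_volume {f g h : ℝ → ℝ} (hf : Measurable f)
    (hg : Measurable g) (hh : Measurable h) (hf0 : 0 ≤ f) (hg0 : 0 ≤ g) (hh0 : 0 ≤ h)
    (hf1 : BddAbove (range f)) (hg1 : BddAbove (range g)) (hfi : Integrable f)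
    (hgi : Integrable g) (hhi : Integrable h)
    (H : ∀ x y, f x * g y ≤ h ((x + y) / 2) ^ 2) :
    (∫ x, f x) * ∫ x, g x ≤ (∫ x, h x) ^ 2 := by
  set F := ⨆ x, f x with hF
  set G := ⨆ x, g x with hG
  have hfF : ∀ x, f x ≤ F := fun x => le_ciSup hf1 x
  have hgG : ∀ x, g x ≤ G := fun x => le_ciSup hg1 x
  have hF0 : 0 ≤ F := (hf0 0).trans (hfF 0)
  have hG0 : 0 ≤ G := (hg0 0).trans (hgG 0)
  rcases hF0.eq_or_lt with hF0 | hF0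
  · have : f = 0 := funext fun x => le_antisymm ((hfF x).trans hF0.symm.le) (hf0 x)
    simp [this, sq_nonneg]
  rcases hG0.eq_or_lt with hG0 | hG0
  · have : g = 0 := funext fun x => le_antisymm ((hgG x).trans hG0.symm.le) (hg0 x)
    simp [this, sq_nonneg]
  have hS : 0 < √(F * G) := Real.sqrt_pos.2 (mul_pos hF0 hG0)
  have hS2 : √(F * G) ^ 2 = F * G := Real.sq_sqrt (mul_pos hF0 hG0).le
  have key := lintegral_add_lintegral_le_of_sup_eq_one (f := fun x => f x / F)
    (g := fun x => g x / G) (h := fun x => h x / √(F * G)) (by fun_prop) (by fun_prop)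
    (by fun_prop) (fun x => div_nonneg (hf0 x) hF0.le) (fun x => div_nonneg (hg0 x) hG0.le)
    (fun x => div_nonneg (hh0 x) hS.le) (fun x => (div_le_one hF0).2 (hfF x))
    (fun x => (div_le_one hG0).2 (hgG x))
    (fun t ht => by
      obtain ⟨x, hx⟩ := exists_lt_of_lt_ciSup (f := f) (b := t * F)
        ((mul_lt_mul_of_pos_right ht hF0).trans_eq (one_mul F))
      exact ⟨x, (lt_div_iff₀ hF0).2 hx⟩)
    (fun t ht => by
      obtain ⟨x, hx⟩ := exists_lt_of_lt_ciSup (f := g) (b := t * G)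
        ((mul_lt_mul_of_pos_right ht hG0).trans_eq (one_mul G))
      exact ⟨x, (lt_div_iff₀ hG0).2 hx⟩)
    (fun x y => by
      rw [div_pow, hS2, div_mul_div_comm]
      exact div_le_div_of_nonneg_right (H x y) (mul_pos hF0 hG0).le)
  rw [← ofReal_integral_eq_lintegral_ofReal (hfi.div_const F)
      (.of_forall fun x => div_nonneg (hf0 x) hF0.le),
    ← ofReal_integral_eq_lintegral_ofReal (hgi.div_const G)
      (.of_forall fun x => div_nonneg (hg0 x) hG0.le),
    ← ofReal_integral_eq_lintegral_ofReal (hhi.div_const _)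
      (.of_forall fun x => div_nonneg (hh0 x) hS.le),
    integral_div, integral_div, integral_div] at key
  have If := integral_nonneg (μ := volume) hf0
  have Ig := integral_nonneg (μ := volume) hg0
  have Ih := integral_nonneg (μ := volume) hh0
  rw [← ENNReal.ofReal_add (by positivity) (by positivity),
    show (2 : ℝ≥0∞) = ENNReal.ofReal 2 by simp, ← ENNReal.ofReal_mul (by norm_num),
    ENNReal.ofReal_le_ofReal_iff (by positivity)] at key
  set If' := ∫ x, f x
  set Ig' := ∫ x, g x
  set Ih' := ∫ x, h x
  have h4 : 4 * ((If' / F) * (Ig' / G)) ≤ (2 * (Ih' / √(F * G))) ^ 2 := by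
    have : (0 : ℝ) ≤ If' / F + Ig' / G := by positivity
    nlinarith [sq_nonneg (If' / F - Ig' / G)]
  rw [mul_pow, div_pow, hS2, div_mul_div_comm] at h4
  have h5 : (If' * Ig') / (F * G) ≤ Ih' ^ 2 / (F * G) := by linarith
  exact (div_le_div_iff_of_pos_right (mul_pos hF0 hG0)).1 h5

/-- The midpoint Prékopa–Leindler inequality for functions with values in `[0, 1]`. -/
def PrekopaLeindler {Y : Type*} [AddCommGroup Y] [Module ℝ Y] [MeasurableSpace Y]
    (μ : Measure Y) : Prop :=
  ∀ f g h : Y → ℝ, Measurable f → Measurable g → Measurable h →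
    (∀ x, f x ∈ Icc (0 : ℝ) 1) → (∀ x, g x ∈ Icc (0 : ℝ) 1) → (∀ x, h x ∈ Icc (0 : ℝ) 1) →
    (∀ x y, f x * g y ≤ h ((1 / 2 : ℝ) • (x + y)) ^ 2) →
    (∫ x, f x ∂μ) * ∫ x, g x ∂μ ≤ (∫ x, h x ∂μ) ^ 2

theorem integrable_of_mem_Icc {Y : Type*} [MeasurableSpace Y] {μ : Measure Y} [IsFiniteMeasure μ]
    {f : Y → ℝ} (hf : Measurable f) (h : ∀ x, f x ∈ Icc (0 : ℝ) 1) : Integrable f μ :=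
  Integrable.of_bound hf.aestronglyMeasurable 1
    (.of_forall fun x => by rw [Real.norm_of_nonneg (h x).1]; exact (h x).2)

theorem integral_mem_Icc {Y : Type*} [MeasurableSpace Y] {μ : Measure Y} [IsProbabilityMeasure μ]
    {f : Y → ℝ} (hf : Measurable f) (h : ∀ x, f x ∈ Icc (0 : ℝ) 1) :
    ∫ x, f x ∂μ ∈ Icc (0 : ℝ) 1 := by
  refine ⟨integral_nonneg fun x => (h x).1, ?_⟩
  simpa using integral_mono (integrable_of_mem_Icc (μ := μ) hf h) (integrable_const 1)
    fun x => (h x).2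

theorem gaussianPDFReal_mem_Icc (x : ℝ) : gaussianPDFReal 0 1 x ∈ Icc (0 : ℝ) 1 := by
  refine ⟨gaussianPDFReal_nonneg 0 1 x, ?_⟩
  have h1 : (1 : ℝ) ≤ √(2 * Real.pi * (1 : ℝ≥0)) := by
    rw [Real.one_le_sqrt]; push_cast; nlinarith [Real.pi_gt_three]
  rw [gaussianPDFReal]
  refine mul_le_one₀ (inv_le_one_of_one_le₀ h1) (Real.exp_pos _).le (Real.exp_le_one_iff.2 ?_)
  have := sq_nonneg (x - 0)
  rw [neg_div]
  exact neg_nonpos.2 (by positivity)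

theorem gaussianPDFReal_mul_le (x y : ℝ) :
    gaussianPDFReal 0 1 x * gaussianPDFReal 0 1 y ≤ gaussianPDFReal 0 1 ((x + y) / 2) ^ 2 := by
  simp only [gaussianPDFReal, mul_pow, ← Real.exp_nat_mul]
  rw [mul_mul_mul_comm, ← Real.exp_add, ← sq]
  gcongr
  push_cast
  nlinarith [sq_nonneg (x - y)]

theorem prekopaLeindler_gaussianReal : PrekopaLeindler (gaussianReal 0 1) := by
  intro f g h hf hg hh hf' hg' hh' H
  have e : ∀ u : ℝ → ℝ, ∫ x, u x ∂gaussianReal 0 1 = ∫ x, gaussianPDFReal 0 1 x * u x :=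
    fun u => by rw [integral_gaussianReal_eq_integral_smul one_ne_zero]; rfl
  have mφ := measurable_gaussianPDFReal 0 1
  have bdd : ∀ u : ℝ → ℝ, (∀ x, u x ∈ Icc (0 : ℝ) 1) →
      BddAbove (range fun x => gaussianPDFReal 0 1 x * u x) := by
    rintro u hu
    refine ⟨1, ?_⟩
    rintro _ ⟨x, rfl⟩
    exact mul_le_one₀ (gaussianPDFReal_mem_Icc x).2 (hu x).1 (hu x).2
  have int : ∀ u : ℝ → ℝ, Measurable u → (∀ x, u x ∈ Icc (0 : ℝ) 1) →
      Integrable fun x => gaussianPDFReal 0 1 x * u x := fun u hu hu' =>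
    (integrable_gaussianPDFReal 0 1).mul_bdd (c := 1) hu.aestronglyMeasurable
      (.of_forall fun x => by rw [Real.norm_of_nonneg (hu' x).1]; exact (hu' x).2)
  rw [e, e, e]
  have nn : ∀ u : ℝ → ℝ, (∀ x, u x ∈ Icc (0 : ℝ) 1) →
      0 ≤ fun x => gaussianPDFReal 0 1 x * u x :=
    fun u hu x => mul_nonneg (gaussianPDFReal_nonneg 0 1 x) (hu x).1
  refine integral_mul_integral_le_sq_of_volume (mφ.mul hf) (mφ.mul hg) (mφ.mul hh) (nn f hf')
    (nn g hg') (nn h hh') (bdd f hf') (bdd g hg') (int f hf hf') (int g hg hg') (int h hh hh') ?_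
  intro x y
  rw [mul_mul_mul_comm, mul_pow]
  have h1 := H x y
  rw [smul_eq_mul, one_div_mul_eq_div] at h1
  exact mul_le_mul (gaussianPDFReal_mul_le x y) h1 (mul_nonneg (hf' x).1 (hg' y).1) (sq_nonneg _)

theorem PrekopaLeindler.prod {X Y : Type*} [AddCommGroup X] [Module ℝ X] [MeasurableSpace X]
    [AddCommGroup Y] [Module ℝ Y] [MeasurableSpace Y] {μ : Measure X} {ν : Measure Y}
    [IsProbabilityMeasure μ] [IsProbabilityMeasure ν] (hμ : PrekopaLeindler μ)
    (hν : PrekopaLeindler ν) : PrekopaLeindler (μ.prod ν) := by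
  intro f g h hf hg hh hf' hg' hh' H
  rw [integral_prod _ (integrable_of_mem_Icc hf hf'),
    integral_prod _ (integrable_of_mem_Icc hg hg'),
    integral_prod _ (integrable_of_mem_Icc hh hh')]
  refine hμ _ _ _ hf.stronglyMeasurable.integral_prod_right'.measurable
    hg.stronglyMeasurable.integral_prod_right'.measurable
    hh.stronglyMeasurable.integral_prod_right'.measurable
    (fun x => integral_mem_Icc (by fun_prop) fun y => hf' _)
    (fun x => integral_mem_Icc (by fun_prop) fun y => hg' _)
    (fun x => integral_mem_Icc (by fun_prop) fun y => hh' _) fun x x' => ?_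
  exact hν _ _ _ (by fun_prop) (by fun_prop) (by fun_prop) (fun y => hf' _) (fun y => hg' _)
    (fun y => hh' _) fun y y' => H (x, y) (x', y')

theorem PrekopaLeindler.map {X Y : Type*} [AddCommGroup X] [Module ℝ X] [MeasurableSpace X]
    [AddCommGroup Y] [Module ℝ Y] [MeasurableSpace Y] {μ : Measure X} (hμ : PrekopaLeindler μ)
    (T : X →ₗ[ℝ] Y) (hT : Measurable T) : PrekopaLeindler (μ.map T) := by
  intro f g h hf hg hh hf' hg' hh' H
  rw [integral_map hT.aemeasurable hf.aestronglyMeasurable,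
    integral_map hT.aemeasurable hg.aestronglyMeasurable,
    integral_map hT.aemeasurable hh.aestronglyMeasurable]
  exact hμ _ _ _ (hf.comp hT) (hg.comp hT) (hh.comp hT) (fun x => hf' _) (fun x => hg' _)
    (fun x => hh' _) fun x y => by simpa using H (T x) (T y)

theorem prekopaLeindler_pi_gaussianReal (n : ℕ) :
    PrekopaLeindler (Measure.pi fun _ : Fin n => gaussianReal 0 1) := by
  induction n with
  | zero =>
    intro f g h _ _ _ _ _ _ H
    rw [Measure.pi_of_empty _ (0 : Fin 0 → ℝ), integral_dirac, integral_dirac, integral_dirac]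
    simpa using H 0 0
  | succ n ih =>
    have hmp := (measurePreserving_piFinSuccAbove
      (fun _ : Fin (n + 1) => gaussianReal 0 1) 0).symm
    rw [← hmp.map_eq]
    have hT : ⇑(MeasurableEquiv.piFinSuccAbove (fun _ : Fin (n + 1) => ℝ) 0).symm
        = (Fin.consLinearEquiv ℝ fun _ : Fin (n + 1) => ℝ).toLinearMap := by
      ext x i
      refine Fin.cases ?_ (fun j => ?_) i <;> simp [MeasurableEquiv.piFinSuccAbove]
    rw [hT]
    exact (prekopaLeindler_gaussianReal.prod ih).map _ (hT ▸ hmp.measurable)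

theorem PrekopaLeindler.measure_mul_le {Y : Type*} [AddCommGroup Y] [Module ℝ Y]
    [MeasurableSpace Y] {μ : Measure Y} (hμ : PrekopaLeindler μ) {A B C : Set Y}
    (hA : MeasurableSet A) (hB : MeasurableSet B) (hC : MeasurableSet C)
    (h : ∀ x ∈ A, ∀ y ∈ B, (1 / 2 : ℝ) • (x + y) ∈ C) :
    μ.real A * μ.real B ≤ μ.real C ^ 2 := by
  have mem : ∀ (S : Set Y) (x : Y), S.indicator (1 : Y → ℝ) x ∈ Icc (0 : ℝ) 1 := fun S x => by
    by_cases hx : x ∈ S <;> simp [hx]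
  have := hμ (A.indicator 1) (B.indicator 1) (C.indicator 1) (measurable_one.indicator hA)
    (measurable_one.indicator hB) (measurable_one.indicator hC) (mem A) (mem B) (mem C) ?_
  · rwa [integral_indicator_one hA, integral_indicator_one hB, integral_indicator_one hC] at this
  · intro x y
    by_cases hx : x ∈ A
    · by_cases hy : y ∈ B
      · rw [indicator_of_mem (h x hx y hy)]
        simp [hx, hy]
      · simp [hy, sq_nonneg]
    · simp [hx, sq_nonneg]

theorem gaussianReal_le_volume : gaussianReal 0 1 ≤ volume := by
  refine Measure.le_iff.2 fun s _ => ?_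
  rw [gaussianReal_apply 0 one_ne_zero]
  calc ∫⁻ x in s, gaussianPDF 0 1 x ≤ ∫⁻ _ in s, 1 := lintegral_mono fun x => by
        rw [gaussianPDF]; exact ENNReal.ofReal_le_one.2 (gaussianPDFReal_mem_Icc x).2
    _ = volume s := by simp

theorem gaussianReal_abs_ge_le {c : ℝ} (hc : 0 < c) :
    (gaussianReal 0 1).real {x | c ≤ |x|} ≤ 1 / c ^ 2 := by
  have := meas_ge_le_variance_div_sq (μ := gaussianReal 0 1) (X := id)
    (memLp_id_gaussianReal 2) hc
  simp only [id, integral_id_gaussianReal, sub_zero] at this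
  refine ENNReal.toReal_le_of_le_ofReal (by positivity) (this.trans_eq ?_)
  rw [variance_id_gaussianReal]
  simp

theorem mul_le_gaussianReal_Ioc {x h : ℝ} (hh : 0 ≤ h) (h1 : -4 ≤ x) (h2 : x + h ≤ 4) :
    h * gaussianPDFReal 0 1 4 ≤ (gaussianReal 0 1).real (Ioc x (x + h)) := by
  rw [measureReal_def, gaussianReal_apply_eq_integral 0 one_ne_zero, ENNReal.toReal_ofReal
    (integral_nonneg fun _ => gaussianPDFReal_nonneg _ _ _)]
  calc h * gaussianPDFReal 0 1 4 = ∫ _ in Ioc x (x + h), gaussianPDFReal 0 1 4 := by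
        simp [hh]
    _ ≤ _ := by
        refine setIntegral_mono_on (by simp) (integrable_gaussianPDFReal 0 1).integrableOn
          measurableSet_Ioc fun y hy => ?_
        have : y ^ 2 ≤ 4 ^ 2 := sq_le_sq' (by linarith [hy.1]) (by linarith [hy.2])
        simp only [gaussianPDFReal, sub_zero]
        gcongr

theorem exists_gaussianReal_Icc_growth : ∃ c : ℝ, 0 < c ∧ ∀ a b h : ℝ, 0 ≤ h → h ≤ 1 → a ≤ b →
    Real.exp (-2) ≤ (gaussianReal 0 1).real (Icc a b) →
    (gaussianReal 0 1).real (Icc a b) < Real.exp (-1) →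
    (gaussianReal 0 1).real (Icc a b) + c * h ≤ (gaussianReal 0 1).real (Icc (a - h) (b + h)) := by
  have : NullSingletonClass (gaussianReal 0 1) := nullSingletonClass_gaussianReal one_ne_zero
  refine ⟨gaussianPDFReal 0 1 4, gaussianPDFReal_pos _ _ _ one_ne_zero, ?_⟩
  intro a b h h0 h1 hab hl hu
  have cheb := gaussianReal_abs_ge_le (c := 3) (by norm_num)
  have e2 : 1 / 3 ^ 2 < Real.exp (-2) := by
    rw [show (-2 : ℝ) = -1 + -1 by norm_num, Real.exp_add]
    have := Real.exp_neg_one_gt_d9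
    nlinarith
  by_cases hb : -3 < b ∧ b < 3
  · have hd : Disjoint (Icc a b) (Ioc b (b + h)) :=
      Set.disjoint_left.2 fun x hx hx' => absurd hx.2 (not_le.2 hx'.1)
    have := mul_le_gaussianReal_Ioc (x := b) h0 (by linarith) (by linarith)
    calc _ ≤ (gaussianReal 0 1).real (Icc a b) + (gaussianReal 0 1).real (Ioc b (b + h)) := by
          linarith
      _ = (gaussianReal 0 1).real (Icc a b ∪ Ioc b (b + h)) :=
          (measureReal_union hd measurableSet_Ioc).symm
      _ ≤ _ := measureReal_mono (union_subset (Icc_subset_Icc (by linarith) (by linarith))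
          fun x hx => ⟨by linarith [hx.1], hx.2⟩)
  by_cases ha : -3 < a ∧ a < 3
  · have hd : Disjoint (Icc a b) (Ico (a - h) a) :=
      Set.disjoint_left.2 fun x hx hx' => absurd hx.1 (not_le.2 hx'.2)
    have := mul_le_gaussianReal_Ioc (x := a - h) h0 (by linarith) (by linarith)
    rw [measureReal_congr Ico_ae_eq_Ioc.symm, sub_add_cancel] at this
    calc _ ≤ (gaussianReal 0 1).real (Icc a b) + (gaussianReal 0 1).real (Ico (a - h) a) := by
          linarith
      _ = (gaussianReal 0 1).real (Icc a b ∪ Ico (a - h) a) :=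
          (measureReal_union hd measurableSet_Ico).symm
      _ ≤ _ := measureReal_mono (union_subset (Icc_subset_Icc (by linarith) (by linarith))
          fun x hx => ⟨hx.1, by linarith [hx.2]⟩)
  exfalso
  rw [not_and_or, not_lt, not_lt] at ha hb
  have outer : Icc a b ⊆ {x | 3 ≤ |x|} → False := fun hsub => by
    have := measureReal_mono (μ := gaussianReal 0 1) hsub
    linarith
  rcases hb with hb | hb
  · exact outer fun x hx => show (3 : ℝ) ≤ |x| from le_abs.2 (Or.inr (by linarith [hx.2]))
  rcases ha with ha | ha
  · have hc : (Icc a b)ᶜ ⊆ {x | 3 ≤ |x|} := fun x hx => by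
      rw [mem_compl_iff, mem_Icc, not_and_or, not_le, not_le] at hx
      rcases hx with hx | hx
      · exact show (3 : ℝ) ≤ |x| from le_abs.2 (Or.inr (by linarith))
      · exact show (3 : ℝ) ≤ |x| from le_abs.2 (Or.inl (by linarith))
    have := measureReal_mono (μ := gaussianReal 0 1) hc
    rw [probReal_compl_eq_one_sub measurableSet_Icc] at this
    have := Real.exp_neg_one_lt_d9
    norm_num at *
    linarith
  · exact outer fun x hx => show (3 : ℝ) ≤ |x| from le_abs.2 (Or.inl (by linarith [hx.1]))

theorem exists_increment_bound {F : ℕ → ℝ} (hmono : Monotone F)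
    (hF : ∀ k, F k * F (k + 2) ≤ F (k + 1) ^ 2) (hF1 : ∀ k, F k ≤ 1) {q n : ℕ}
    (hq : 1 / 10 ≤ F q) (hn : 2 * q + 2 ≤ n) :
    ∃ δ : ℝ, 0 ≤ δ ∧ (∀ k, n ≤ k + 1 → F (k + 1) - F k ≤ δ) ∧ q * δ / 10 ≤ F (2 * q) - F q := by
  have pos : ∀ k, q ≤ k → 0 < F k := fun k hk => by linarith [hmono hk]
  have hanti : Antitone fun k => F (q + k + 1) / F (q + k) := antitone_nat_of_succ_le fun k => by
    rw [div_le_div_iff₀ (pos _ (by omega)) (pos _ (by omega))]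
    have := hF (q + k)
    rw [show q + (k + 1) + 1 = q + k + 2 by ring, show q + (k + 1) = q + k + 1 by ring]
    nlinarith
  obtain ⟨p, rfl⟩ : ∃ p, n = q + p + 2 := ⟨n - q - 2, by omega⟩
  set ρ := F (q + p + 1) / F (q + p) with hρ
  have hρ1 : 1 ≤ ρ := (one_le_div (pos _ (by omega))).2 (hmono (by omega))
  refine ⟨ρ - 1, by linarith, fun k hk => ?_, ?_⟩
  · obtain ⟨j, rfl⟩ : ∃ j, k = q + j := ⟨k - q, by omega⟩
    have h1 : F (q + j + 1) / F (q + j) ≤ ρ := hanti (by omega : p ≤ j)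
    rw [div_le_iff₀ (pos _ (by omega))] at h1
    nlinarith [hF1 (q + j), pos (q + j) (by omega)]
  · have step : ∀ j ≤ q, j * (ρ - 1) / 10 ≤ F (q + j) - F q := by
      intro j
      induction j with
      | zero => simp
      | succ j ih =>
        intro hj
        have h1 : ρ ≤ F (q + j + 1) / F (q + j) := hanti (by omega : j ≤ p)
        rw [le_div_iff₀ (pos _ (by omega))] at h1
        have h2 := hmono (by omega : q ≤ q + j)
        have h3 := ih (by omega)
        push_cast
        rw [← add_assoc]
        nlinarith
    have := step q le_rfl
    rwa [← two_mul] at this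

theorem sum_exp_neg_div_le {q : ℕ} (hq : 0 < q) (n M : ℕ) :
    ∑ k ∈ Finset.Ico n M, Real.exp (-(k / q : ℝ)) ≤ (q + 1) * Real.exp (-(n / q : ℝ)) := by
  have hq' : (0 : ℝ) < q := by exact_mod_cast hq
  have key : ∀ k : ℕ, Real.exp (-(k / q : ℝ)) ≤
      (q + 1) * Real.exp (-(k / q : ℝ)) - (q + 1) * Real.exp (-((k + 1 : ℕ) / q : ℝ)) := by
    intro k
    have h1 : Real.exp (-((k + 1 : ℕ) / q : ℝ)) * (1 + 1 / q) ≤ Real.exp (-(k / q : ℝ)) := by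
      have : Real.exp (-(k / q : ℝ)) = Real.exp (-((k + 1 : ℕ) / q : ℝ)) * Real.exp (1 / q) := by
        rw [← Real.exp_add]; congr 1; push_cast; ring
      rw [this]
      gcongr
      linarith [Real.add_one_le_exp (1 / q : ℝ)]
    have h2 : Real.exp (-((k + 1 : ℕ) / q : ℝ)) * (1 + 1 / q) * q
        = (q + 1) * Real.exp (-((k + 1 : ℕ) / q : ℝ)) := by field_simp
    nlinarith
  rcases le_total n M with h | h
  · suffices H : ∑ k ∈ Finset.Ico n M, Real.exp (-(k / q : ℝ)) ≤
        (q + 1) * Real.exp (-(n / q : ℝ)) - (q + 1) * Real.exp (-(M / q : ℝ)) by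
      have : 0 ≤ (q + 1) * Real.exp (-(M / q : ℝ)) := by positivity
      linarith
    induction M, h using Nat.le_induction with
    | base => simp
    | succ M hM ih =>
      rw [Finset.sum_Ico_succ_top hM]
      linarith [key M]
  · rw [Finset.Ico_eq_empty_of_le h, Finset.sum_empty]; positivity

theorem le_sum_layers {q n : ℕ} {m : ℝ} {χ : ℕ → ℝ} (hχ : ∀ k, χ k = 0 ∨ χ k = 1)
    (hmono : Monotone χ) (hm : ∀ k, n ≤ k → χ k = 0 → m ≤ Real.exp (-(k / q : ℝ)))
    (h0 : χ n = 0) {M : ℕ} (hM : n ≤ M) :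
    m ≤ ∑ k ∈ Finset.Ico n M, Real.exp (-(k / q : ℝ)) * (χ (k + 1) - χ k)
      + (1 - χ M) * Real.exp (-(M / q : ℝ)) := by
  induction M, hM using Nat.le_induction with
  | base => simpa [h0] using hm n le_rfl h0
  | succ M hM ih =>
    rw [Finset.sum_Ico_succ_top hM]
    have hs : 0 ≤ ∑ k ∈ Finset.Ico n M, Real.exp (-(k / q : ℝ)) * (χ (k + 1) - χ k) :=
      Finset.sum_nonneg fun k _ => mul_nonneg (Real.exp_pos _).le
        (sub_nonneg.2 (hmono (Nat.le_succ k)))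
    rcases hχ M with h | h <;> rcases hχ (M + 1) with h' | h'
    · have := hm (M + 1) (by omega) h'
      simp only [h, h', sub_zero, mul_zero, add_zero, one_mul]
      linarith
    · simp only [h, h', sub_zero, one_mul] at ih ⊢
      linarith
    · have := hmono (Nat.le_succ M)
      rw [Nat.succ_eq_add_one, h, h'] at this
      linarith
    · simp only [h, h', sub_self, zero_mul, mul_zero, add_zero] at ih ⊢
      linarith

theorem exists_eq_Icc_of_isCompact_convex {S : Set ℝ} (hS : IsCompact S) (hconv : Convex ℝ S)
    (hne : S.Nonempty) : ∃ a b, a ≤ b ∧ S = Icc a b := by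
  have h := eq_Icc_of_connected_compact ⟨hne, hconv.isPreconnected⟩ hS
  refine ⟨sInf S, sSup S, ?_, h⟩
  by_contra hlt
  rw [h, Icc_eq_empty hlt] at hne
  exact hne.ne_empty rfl

theorem gaussianReal_real_le_volume_real {S : Set ℝ} (hS : IsCompact S) :
    (gaussianReal 0 1).real S ≤ volume.real S :=
  ENNReal.toReal_mono hS.measure_lt_top.ne (gaussianReal_le_volume S)

/-- The Gaussian measure of a convex set does not decrease when all its slices of length less than
`2 * h` are deleted and all its other slices are lengthened by `h` at both ends, provided that `h` is
small. The parameters `q` and `n` describe the layers used in the comparison. -/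
theorem gaussian_prod_real_le_of_thickening {Y : Type*} [AddCommGroup Y] [Module ℝ Y]
    [MeasurableSpace Y] {ν : Measure Y} [IsProbabilityMeasure ν] (hν : PrekopaLeindler ν)
    {c : ℝ} (hc : ∀ a b h : ℝ, 0 ≤ h → h ≤ 1 → a ≤ b →
      Real.exp (-2) ≤ (gaussianReal 0 1).real (Icc a b) →
      (gaussianReal 0 1).real (Icc a b) < Real.exp (-1) →
      (gaussianReal 0 1).real (Icc a b) + c * h ≤ (gaussianReal 0 1).real (Icc (a - h) (b + h)))
    {q n : ℕ} {h : ℝ} (hq0 : 0 < q) (hq : 40 ≤ c * q) (hn : 2 * q + 2 ≤ n) (h0 : 0 < h)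
    (hnh : 20 * h * n ≤ 1) (hexp : Real.exp (-(n / q : ℝ)) * q ≤ h)
    {K K' : Set (ℝ × Y)} (hK : MeasurableSet K) (hK' : MeasurableSet K') (hconv : Convex ℝ K)
    (hcomp : ∀ y, IsCompact ((fun s => (s, y)) ⁻¹' K))
    (hthick : ∀ y a b, a + 2 * h ≤ b → (fun s => (s, y)) ⁻¹' K = Icc a b →
      Icc (a - h) (b + h) ⊆ (fun s => (s, y)) ⁻¹' K')
    (hhalf : 1 / 2 ≤ ((gaussianReal 0 1).prod ν).real K) :
    ((gaussianReal 0 1).prod ν).real K ≤ ((gaussianReal 0 1).prod ν).real K' := by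
  have hq' : (0 : ℝ) < q := by exact_mod_cast hq0
  have hn' : (2 * q + 2 : ℝ) ≤ n := by exact_mod_cast hn
  have hn0 : (0 : ℝ) < n := by linarith
  have h1 : h ≤ 1 := by nlinarith
  set γ := gaussianReal 0 1 with hγ
  let sl : Y → Set ℝ := fun y => (fun s => (s, y)) ⁻¹' K
  let m : Y → ℝ := fun y => γ.real (sl y)
  let m' : Y → ℝ := fun y => γ.real ((fun s => (s, y)) ⁻¹' K')
  let len : Y → ℝ := fun y => volume.real (sl y)
  have hm : Measurable m := (measurable_measure_prodMk_right hK).ennreal_toReal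
  have hm' : Measurable m' := (measurable_measure_prodMk_right hK').ennreal_toReal
  have hlen : Measurable len := (measurable_measure_prodMk_right hK).ennreal_toReal
  have m01 : ∀ y, m y ∈ Icc (0 : ℝ) 1 := fun y => ⟨measureReal_nonneg, measureReal_le_one⟩
  have m'01 : ∀ y, m' y ∈ Icc (0 : ℝ) 1 := fun y => ⟨measureReal_nonneg, measureReal_le_one⟩
  have mlen : ∀ y, m y ≤ len y := fun y => gaussianReal_real_le_volume_real (hcomp y)
  have intm : Integrable m ν := integrable_of_mem_Icc hm m01
  have intm' : Integrable m' ν := integrable_of_mem_Icc hm' m'01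
  have eK : ∀ {L : Set (ℝ × Y)}, MeasurableSet L →
      (γ.prod ν).real L = ∫ y, γ.real ((fun s => (s, y)) ⁻¹' L) ∂ν := fun {L} hL => by
    simp only [measureReal_def]
    rw [Measure.prod_apply_symm hL, integral_toReal]
    · exact (measurable_measure_prodMk_right hL).aemeasurable
    · exact .of_forall fun y => measure_lt_top _ _
  rw [eK hK] at hhalf
  rw [eK hK, eK hK']
  change 1 / 2 ≤ ∫ y, m y ∂ν at hhalf
  change ∫ y, m y ∂ν ≤ ∫ y, m' y ∂ν
  let S : ℕ → Set Y := fun k => {y | Real.exp (-(k / q : ℝ)) ≤ m y ∧ 2 * h * (n - k) ≤ len y}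
  have hS : ∀ k, MeasurableSet (S k) := fun k =>
    (measurableSet_le measurable_const hm).inter (measurableSet_le measurable_const hlen)
  have hSmono : Monotone S := monotone_nat_of_le_succ fun k y hy => by
    refine ⟨le_trans ?_ hy.1, le_trans ?_ hy.2⟩
    · gcongr; simp
    · push_cast; nlinarith
  let F : ℕ → ℝ := fun k => ν.real (S k)
  have hFmono : Monotone F := fun i j hij => measureReal_mono (hSmono hij)
  have hFlog : ∀ k, F k * F (k + 2) ≤ F (k + 1) ^ 2 := fun k => by
    refine hν.measure_mul_le (hS _) (hS _) (hS _) fun y hy y' hy' => ?_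
    have hmid : ∀ s ∈ sl y, ∀ s' ∈ sl y', (s + s') / 2 ∈ sl ((1 / 2 : ℝ) • (y + y')) := by
      intro s hs s' hs'
      have := hconv hs hs' (by norm_num : (0 : ℝ) ≤ 1 / 2) (by norm_num : (0 : ℝ) ≤ 1 / 2)
        (by norm_num)
      have e : ((s + s') / 2, (1 / 2 : ℝ) • (y + y'))
          = (1 / 2 : ℝ) • (s, y) + (1 / 2 : ℝ) • (s', y') := by
        simp only [Prod.smul_mk, Prod.mk_add_mk, smul_add, Prod.mk.injEq, smul_eq_mul, and_true]
        ring
      change ((s + s') / 2, (1 / 2 : ℝ) • (y + y')) ∈ K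
      rwa [e]
    constructor
    · have h2 := prekopaLeindler_gaussianReal.measure_mul_le (hcomp y).measurableSet
        (hcomp y').measurableSet (hcomp ((1 / 2 : ℝ) • (y + y'))).measurableSet
        fun s hs s' hs' => by
          rw [smul_eq_mul, one_div_mul_eq_div]; exact hmid s hs s' hs'
      refine le_of_sq_le_sq ?_ (m01 _).1
      refine le_trans ?_ h2
      refine le_trans (le_of_eq ?_) (mul_le_mul hy.1 hy'.1 (Real.exp_pos _).le (m01 y).1)
      rw [← Real.exp_nat_mul, ← Real.exp_add]
      congr 1
      push_cast
      field_simp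
      ring
    · have ne : ∀ z, 0 < m z → (sl z).Nonempty := fun z hz => by
        by_contra hne
        rw [not_nonempty_iff_eq_empty] at hne
        simp [m, hne] at hz
      have h2 := volume_add_volume_le_of_isCompact (hcomp y) (hcomp y')
        (ne y ((Real.exp_pos _).trans_le hy.1)) (ne y' ((Real.exp_pos _).trans_le hy'.1)) hmid
      have h3 : len y + len y' ≤ 2 * len ((1 / 2 : ℝ) • (y + y')) := by
        have := ENNReal.toReal_mono
          (ENNReal.mul_ne_top (by simp) (hcomp ((1 / 2 : ℝ) • (y + y'))).measure_lt_top.ne) h2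
        rwa [ENNReal.toReal_add (hcomp y).measure_lt_top.ne (hcomp y').measure_lt_top.ne,
          ENNReal.toReal_mul] at this
      have h4 := hy.2
      have h5 := hy'.2
      push_cast at h5 ⊢
      nlinarith
  have hSq : ∀ y, Real.exp (-1) ≤ m y → y ∈ S q := fun y hy => by
    refine ⟨by rwa [div_self hq'.ne'], le_trans ?_ ((hy.trans (mlen y)))⟩
    have := Real.exp_neg_one_gt_d9
    nlinarith
  have hFq : 1 / 10 ≤ F q := by
    have h2 : ∫ y, m y ∂ν ≤ ∫ y, ((S q).indicator 1 y + Real.exp (-1)) ∂ν := by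
      refine integral_mono intm (((integrable_const 1).indicator (hS q)).add
        (integrable_const _)) fun y => ?_
      by_cases hy : y ∈ S q
      · simp only [indicator_of_mem hy, Pi.one_apply]
        linarith [(m01 y).2, Real.exp_pos (-1)]
      · simp only [indicator_of_notMem hy, zero_add]
        exact (not_le.1 fun hle => hy (hSq y hle)).le
    rw [integral_add ((integrable_const 1).indicator (hS q)) (integrable_const _),
      integral_indicator_one (hS q)] at h2
    simp only [integral_const, probReal_univ, one_smul] at h2
    have := Real.exp_neg_one_lt_d9
    linarith
  obtain ⟨δ, hδ0, hδ, hgain⟩ := exists_increment_bound hFmono hFlog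
    (fun k => measureReal_le_one) hFq hn
  let χ : ℕ → Y → ℝ := fun k => (S k).indicator 1
  have χ01 : ∀ y k, χ k y = 0 ∨ χ k y = 1 := fun y k => by
    by_cases hy : y ∈ S k <;> simp [χ, hy]
  have χmono : ∀ y, Monotone fun k => χ k y := fun y i j hij =>
    indicator_le_indicator_of_subset (hSmono hij) (fun _ => zero_le_one) y
  have χint : ∀ k, Integrable (χ k) ν := fun k => (integrable_const 1).indicator (hS k)
  have χI : ∀ k, ∫ y, χ k y ∂ν = F k := fun k => integral_indicator_one (hS k)
  have pointwise : ∀ M, n ≤ M → ∀ y, m y + c * h * (χ (2 * q) y - χ q y) ≤ m' y +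
      (2 * h * (χ n y - χ (n - 1) y)
      + ∑ k ∈ Finset.Ico n M, Real.exp (-(k / q : ℝ)) * (χ (k + 1) y - χ k y)
      + Real.exp (-(M / q : ℝ))) := by
    intro M hM y
    have s1 : 0 ≤ 2 * h * (χ n y - χ (n - 1) y) :=
      mul_nonneg (by positivity) (sub_nonneg.2 (χmono y (by omega)))
    have s2 : 0 ≤ ∑ k ∈ Finset.Ico n M, Real.exp (-(k / q : ℝ)) * (χ (k + 1) y - χ k y) :=
      Finset.sum_nonneg fun k _ => mul_nonneg (Real.exp_pos _).le
        (sub_nonneg.2 (χmono y (Nat.le_succ k)))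
    have s3 := Real.exp_pos (-(M / q : ℝ))
    rcases lt_or_ge (len y) (2 * h) with hshort | hlong
    · have zero : ∀ k, k + 1 ≤ n → χ k y = 0 := fun k hk => by
        refine indicator_of_notMem (fun hy => ?_) _
        have := hy.2
        have hk' : (k + 1 : ℝ) ≤ n := by exact_mod_cast hk
        nlinarith
      rw [zero (2 * q) (by omega), zero q (by omega), zero (n - 1) (by omega)]
      have nn' := (m'01 y).1
      rcases χ01 y n with hy | hy
      · have := le_sum_layers (q := q) (m := m y) (χ01 y) (χmono y) (fun k hk hky => ?_) hy hM
        · have hle : (1 - χ M y) * Real.exp (-(M / q : ℝ)) ≤ Real.exp (-(M / q : ℝ)) := by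
            rcases χ01 y M with h | h <;> simp [h, Real.exp_nonneg]
          rw [hy]
          linarith
        · by_contra hlt
          have : y ∈ S k := by
            refine ⟨(not_le.1 hlt).le, le_trans ?_ measureReal_nonneg⟩
            have : (n : ℝ) ≤ k := by exact_mod_cast hk
            nlinarith
          simp [χ, this] at hky
      · rw [hy]
        linarith [mlen y]
    · have hne : (sl y).Nonempty := by
        by_contra hne
        rw [not_nonempty_iff_eq_empty] at hne
        simp only [len, hne, measureReal_empty] at hlong
        linarith
      have hslc : Convex ℝ (sl y) := by
        intro s hs t ht u v hu hv huv
        have := hconv hs ht hu hv huv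
        have e : (u • s + v • t, y) = u • (s, y) + v • (t, y) := by
          simp [← add_smul, huv]
        change (u • s + v • t, y) ∈ K
        rwa [e]
      obtain ⟨a, b, hab, hsl⟩ := exists_eq_Icc_of_isCompact_convex (hcomp y) hslc hne
      have hlen : len y = b - a := by
        simp only [len]
        rw [show sl y = Icc a b from hsl, Real.volume_real_Icc_of_le hab]
      have hm'' : γ.real (Icc (a - h) (b + h)) ≤ m' y :=
        measureReal_mono (hthick y a b (by linarith) hsl)
      have hmm : m y = γ.real (Icc a b) := by rw [← hsl]
      have hmm' : m y ≤ m' y := by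
        rw [hmm]
        exact (measureReal_mono (Icc_subset_Icc (by linarith) (by linarith))).trans hm''
      by_cases hy : y ∈ S (2 * q) ∧ y ∉ S q
      · have g1 : χ (2 * q) y = 1 := indicator_of_mem hy.1 _
        have g2 : χ q y = 0 := indicator_of_notMem hy.2 _
        have g3 : Real.exp (-2) ≤ m y := by
          have := hy.1.1
          rwa [Nat.cast_mul, mul_div_assoc, div_self hq'.ne', Nat.cast_ofNat, mul_one] at this
        have g4 : m y < Real.exp (-1) := not_le.1 fun hle => hy.2 (hSq y hle)
        rw [hmm] at g3 g4
        have := hc a b h h0.le h1 hab g3 g4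
        rw [g1, g2, hmm]
        linarith
      · have : χ (2 * q) y - χ q y = 0 := by
          by_cases hyq : y ∈ S q
          · simp [χ, hyq, hSmono (by omega : q ≤ 2 * q) hyq]
          · have : y ∉ S (2 * q) := fun h2 => hy ⟨h2, hyq⟩
            simp [χ, hyq, this]
        rw [this]
        linarith
  have integrated : ∀ M, n ≤ M → ∫ y, m y ∂ν ≤ ∫ y, m' y ∂ν + Real.exp (-(M / q : ℝ)) := by
    intro M hM
    have i1 : Integrable (fun y => c * h * (χ (2 * q) y - χ q y)) ν :=
      ((χint _).sub (χint _)).const_mul _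
    have i2 : Integrable (fun y => 2 * h * (χ n y - χ (n - 1) y)) ν :=
      ((χint _).sub (χint _)).const_mul _
    have i3 : ∀ k ∈ Finset.Ico n M,
        Integrable (fun y => Real.exp (-(k / q : ℝ)) * (χ (k + 1) y - χ k y)) ν :=
      fun k _ => ((χint _).sub (χint _)).const_mul _
    have i3' := integrable_finsetSum _ i3
    have i4 : Integrable (fun y => 2 * h * (χ n y - χ (n - 1) y) +
        ∑ k ∈ Finset.Ico n M, Real.exp (-(k / q : ℝ)) * (χ (k + 1) y - χ k y)) ν := i2.add i3'
    have i5 : Integrable (fun y => 2 * h * (χ n y - χ (n - 1) y) +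
        ∑ k ∈ Finset.Ico n M, Real.exp (-(k / q : ℝ)) * (χ (k + 1) y - χ k y) +
        Real.exp (-(M / q : ℝ))) ν := i4.add (integrable_const _)
    have := integral_mono (intm.add i1) (intm'.add i5) (pointwise M hM)
    have e1 : ∀ (u : ℝ) (i j : ℕ), ∫ y, u * (χ i y - χ j y) ∂ν = u * (F i - F j) :=
      fun u i j => by rw [integral_const_mul, integral_sub (χint _) (χint _), χI, χI]
    simp only [Pi.add_apply] at this
    rw [integral_add intm i1, integral_add intm' i5, integral_add i4 (integrable_const _),
      integral_add i2 i3', integral_finsetSum _ i3] at this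
    simp only [e1, integral_const, probReal_univ, one_smul] at this
    have b1 : F n - F (n - 1) ≤ δ := by
      have := hδ (n - 1) (by omega)
      rwa [Nat.sub_add_cancel (by omega)] at this
    have b2 : ∑ k ∈ Finset.Ico n M, Real.exp (-(k / q : ℝ)) * (F (k + 1) - F k) ≤ 2 * h * δ := by
      calc _ ≤ ∑ k ∈ Finset.Ico n M, Real.exp (-(k / q : ℝ)) * δ := by
            refine Finset.sum_le_sum fun k hk => ?_
            have := hδ k (by rw [Finset.mem_Ico] at hk; omega)
            gcongr
        _ ≤ ((q + 1) * Real.exp (-(n / q : ℝ))) * δ := by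
            rw [← Finset.sum_mul]
            gcongr
            exact sum_exp_neg_div_le hq0 n M
        _ ≤ _ := by
            have : (1 : ℝ) ≤ q := by exact_mod_cast hq0
            have := Real.exp_pos (-(n / q : ℝ))
            refine mul_le_mul_of_nonneg_right ?_ hδ0
            nlinarith
    have b3 : 4 * h * δ ≤ c * h * (F (2 * q) - F q) := by
      have hc0 : 0 < c := by
        by_contra hneg
        nlinarith [not_lt.1 hneg]
      calc 4 * h * δ ≤ (c * q) * h * δ / 10 := by nlinarith [mul_nonneg h0.le hδ0]
        _ = c * h * (q * δ / 10) := by ring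
        _ ≤ _ := by gcongr
    nlinarith
  have hlim : Filter.Tendsto (fun M : ℕ => ∫ y, m' y ∂ν + Real.exp (-(M / q : ℝ))) Filter.atTop
      (nhds (∫ y, m' y ∂ν + 0)) := by
    refine tendsto_const_nhds.add (Real.tendsto_exp_neg_atTop_nhds_zero.comp ?_)
    exact tendsto_natCast_atTop_atTop.atTop_div_const hq'
  rw [add_zero] at hlim
  exact ge_of_tendsto hlim (Filter.eventually_atTop.2 ⟨n, integrated⟩)

theorem exists_gaussian_thickening_radius : ∃ h : ℝ, 0 < h ∧
    ∀ (n : ℕ) (K K' : Set (ℝ × (Fin n → ℝ))), MeasurableSet K → MeasurableSet K' → Convex ℝ K →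
      (∀ y, IsCompact ((fun s => (s, y)) ⁻¹' K)) →
      (∀ y a b, a + 2 * h ≤ b → (fun s => (s, y)) ⁻¹' K = Icc a b →
        Icc (a - h) (b + h) ⊆ (fun s => (s, y)) ⁻¹' K') →
      1 / 2 ≤ ((gaussianReal 0 1).prod (Measure.pi fun _ : Fin n => gaussianReal 0 1)).real K →
      ((gaussianReal 0 1).prod (Measure.pi fun _ : Fin n => gaussianReal 0 1)).real K ≤
        ((gaussianReal 0 1).prod (Measure.pi fun _ : Fin n => gaussianReal 0 1)).real K' := by
  obtain ⟨c, hc0, hc⟩ := exists_gaussianReal_Icc_growth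
  obtain ⟨q, hq⟩ := exists_nat_ge (40 / c)
  have hq' : (0 : ℝ) < q := (by positivity : (0 : ℝ) < 40 / c).trans_le hq
  have hlim : Filter.Tendsto (fun n : ℕ => (n / q : ℝ) ^ 1 * Real.exp (-(n / q : ℝ))) Filter.atTop
      (nhds 0) :=
    (Real.tendsto_pow_mul_exp_neg_atTop_nhds_zero 1).comp
      (tendsto_natCast_atTop_atTop.atTop_div_const hq')
  obtain ⟨m, hm1, hm2⟩ := ((hlim.eventually (ge_mem_nhds
    (by positivity : 0 < 1 / (20 * q * q : ℝ)))).and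
    (Filter.eventually_ge_atTop (2 * q + 2))).exists
  have hm0 : (0 : ℝ) < m := by
    have : 0 < m := by omega
    exact_mod_cast this
  refine ⟨1 / (20 * m), by positivity, fun n K K' hK hK' hconv hcomp hthick hhalf => ?_⟩
  refine gaussian_prod_real_le_of_thickening (prekopaLeindler_pi_gaussianReal n) hc (q := q)
    (n := m) (by exact_mod_cast hq') ?_ hm2 (by positivity) (by field_simp; rfl) ?_ hK hK' hconv
    hcomp hthick hhalf
  · rwa [div_le_iff₀' hc0] at hq
  · rw [pow_one, le_div_iff₀ (by positivity)] at hm1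
    rw [le_div_iff₀ (by positivity)]
    calc _ = (m / q : ℝ) * Real.exp (-(m / q : ℝ)) * (20 * q * q) := by field_simp
      _ ≤ _ := hm1

theorem exists_orthonormalBasis_fin_succ {E : Type*} [NormedAddCommGroup E]
    [InnerProductSpace ℝ E] [FiniteDimensional ℝ E] {e : E} (he : ‖e‖ = 1) :
    ∃ (n : ℕ) (b : OrthonormalBasis (Fin (n + 1)) ℝ E), b 0 = e := by
  have : Nontrivial E := ⟨⟨e, 0, fun h => by simp [h] at he⟩⟩
  obtain ⟨n, hn⟩ := Nat.exists_eq_succ_of_ne_zero (Module.finrank_pos (R := ℝ) (M := E)).ne'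
  have hv : Orthonormal ℝ (({0} : Set (Fin (n + 1))).domRestrict fun _ => e) := by
    refine ⟨fun _ => he, fun i j hij => absurd (Subsingleton.elim i j) hij⟩
  obtain ⟨b, hb⟩ := hv.exists_orthonormalBasis_extension_of_card_eq (by simpa using hn)
  exact ⟨n, b, hb 0 rfl⟩

theorem stdGaussian_eq_map_prod {E : Type*} [NormedAddCommGroup E]
    [InnerProductSpace ℝ E] [FiniteDimensional ℝ E] [MeasurableSpace E] [BorelSpace E] {n : ℕ}
    (b : OrthonormalBasis (Fin (n + 1)) ℝ E) :
    stdGaussian E = ((gaussianReal 0 1).prod (Measure.pi fun _ : Fin n => gaussianReal 0 1)).map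
      fun z => z.1 • b 0 + ∑ i, z.2 i • b i.succ := by
  rw [stdGaussian_eq_map_pi_orthonormalBasis b]
  have h := (measurePreserving_piFinSuccAbove (fun _ : Fin (n + 1) => gaussianReal 0 1) 0)
  rw [← h.map_eq, Measure.map_map (by fun_prop) h.measurable]
  congr 1
  ext x
  simp [Fin.sum_univ_succ, MeasurableEquiv.piFinSuccAbove, Fin.tail]

/-- A symmetric form of Banaszczyk's balancing step: a convex body of Gaussian measure at least
`1 / 2` can be replaced by one of no smaller measure each of whose points can be moved into the
original body by adding or subtracting a given short vector. -/
theorem exists_balancing_radius : ∃ h : ℝ, 0 < h ∧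
    ∀ (E : Type) [NormedAddCommGroup E] [InnerProductSpace ℝ E] [FiniteDimensional ℝ E]
      [MeasurableSpace E] [BorelSpace E] (K : Set E) (u : E), IsCompact K → Convex ℝ K →
      (∀ x ∈ K, -x ∈ K) → 1 / 2 ≤ (stdGaussian E).real K → ‖u‖ = h →
      ∃ K' : Set E, IsCompact K' ∧ Convex ℝ K' ∧ (∀ x ∈ K', -x ∈ K') ∧
        (stdGaussian E).real K ≤ (stdGaussian E).real K' ∧ ∀ x ∈ K', x - u ∈ K ∨ x + u ∈ K := by
  obtain ⟨h, h0, H⟩ := exists_gaussian_thickening_radius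
  refine ⟨h, h0, fun E _ _ _ _ _ K u hK hconv hsymm hhalf hu => ?_⟩
  let C : Set E := (fun x => x + u) ⁻¹' K ∩ (fun x => x + -u) ⁻¹' K
  let I : Set E := (fun r : ℝ => r • u) '' Icc (-2) 2
  have hC : IsCompact C :=
    ((Homeomorph.addRight u).isCompact_preimage.2 hK).inter
      ((Homeomorph.addRight (-u)).isCompact_preimage.2 hK)
  have hI : IsCompact I := isCompact_Icc.image (by fun_prop)
  have hCconv : Convex ℝ C := (hconv.translate_preimage_left u).inter
    (hconv.translate_preimage_left (-u))
  have hIconv : Convex ℝ I := (convex_Icc (-2 : ℝ) 2).linear_image (LinearMap.toSpanSingleton ℝ E u)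
  have hCI := hC.add hI
  refine ⟨C + I, hCI, hCconv.add hIconv, ?_, ?_, ?_⟩
  · rintro _ ⟨x, ⟨hx1, hx2⟩, _, ⟨r, hr, rfl⟩, rfl⟩
    refine ⟨-x, ⟨?_, ?_⟩, (-r) • u, ⟨-r, ⟨by linarith [hr.2], by linarith [hr.1]⟩, rfl⟩, ?_⟩
    · have := hsymm _ hx2
      simpa [add_comm] using this
    · have := hsymm _ hx1
      simpa [add_comm] using this
    · simp only [neg_smul]; abel
  · obtain ⟨n, b, hb⟩ := exists_orthonormalBasis_fin_succ (e := h⁻¹ • u)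
      (by rw [norm_smul, hu, norm_inv, Real.norm_of_nonneg h0.le, inv_mul_cancel₀ h0.ne'])
    have hub : u = h • b 0 := by rw [hb, smul_inv_smul₀ h0.ne']
    let φ : ℝ × (Fin n → ℝ) → E := fun z => z.1 • b 0 + ∑ i, z.2 i • b i.succ
    have hφ : Continuous φ := by fun_prop
    have hlin : IsLinearMap ℝ φ := by
      constructor
      · intro z w
        simp only [φ, Prod.fst_add, Prod.snd_add, Pi.add_apply, add_smul, Finset.sum_add_distrib]
        abel
      · intro r z
        simp only [φ, Prod.smul_fst, Prod.smul_snd, Pi.smul_apply, smul_eq_mul, smul_add,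
          Finset.smul_sum, mul_smul]
    have heq : stdGaussian E = _ := stdGaussian_eq_map_prod b
    have key : ∀ L : Set E, MeasurableSet L → (stdGaussian E).real L =
        ((gaussianReal 0 1).prod (Measure.pi fun _ : Fin n => gaussianReal 0 1)).real (φ ⁻¹' L) :=
      fun L hL => by rw [heq, map_measureReal_apply hφ.measurable hL]
    have hadd : ∀ (s t : ℝ) (y : Fin n → ℝ), φ (s, y) + t • u = φ (s + t * h, y) := by
      intro s t y
      simp only [φ, hub, add_smul, mul_smul]
      abel
    rw [key K hK.measurableSet, key _ hCI.measurableSet]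
    rw [key K hK.measurableSet] at hhalf
    refine H n _ _ (hφ.measurable hK.measurableSet) (hφ.measurable hCI.measurableSet)
      (hconv.is_linear_preimage hlin) (fun y => ?_) (fun y a a' ha hsl s hs => ?_) hhalf
    · have hemb : Topology.IsClosedEmbedding fun s : ℝ => φ (s, y) := by
        have h1 : Isometry fun s : ℝ => φ (s, y) := by
          refine Isometry.of_dist_eq fun s t => ?_
          simp only [φ, dist_eq_norm, add_sub_add_right_eq_sub, ← sub_smul, norm_smul,
            b.orthonormal.1, mul_one]
        exact h1.isClosedEmbedding
      exact hemb.isCompact_preimage hK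
    · have hmem : ∀ t ∈ Icc a a', φ (t, y) ∈ K := fun t ht => by
        rw [← hsl] at ht
        exact ht
      set t := max (a + h) (min s (a' - h)) with ht
      have ht1 : a + h ≤ t := le_max_left _ _
      have ht2 : t ≤ a' - h := max_le (by linarith) (min_le_right _ _)
      have hst : |s - t| ≤ 2 * h := by
        have := hs.1
        have := hs.2
        rw [abs_le, ht]
        rcases max_cases (a + h) (min s (a' - h)) with h1 | h1 <;>
        rcases min_cases s (a' - h) with h2 | h2 <;> constructor <;> linarith
      refine ⟨φ (t, y), ⟨?_, ?_⟩, ((s - t) / h) • u, ⟨(s - t) / h, ?_, rfl⟩, ?_⟩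
      · have := hadd t 1 y
        rw [one_smul, one_mul] at this
        change φ (t, y) + u ∈ K
        rw [this]
        exact hmem _ ⟨by linarith, by linarith⟩
      · have := hadd t (-1) y
        rw [neg_smul, one_smul, neg_one_mul] at this
        change φ (t, y) + -u ∈ K
        rw [this]
        exact hmem _ ⟨by linarith, by linarith⟩
      · rw [abs_le] at hst
        constructor
        · rw [le_div_iff₀ h0]; linarith
        · rw [div_le_iff₀ h0]; linarith
      · change φ (t, y) + _ = φ (s, y)
        rw [hadd, div_mul_cancel₀ _ h0.ne', add_sub_cancel]
  · rintro _ ⟨x, ⟨hx1, hx2⟩, _, ⟨r, hr, rfl⟩, rfl⟩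
    change x + u ∈ K at hx1
    change x + -u ∈ K at hx2
    rcases le_total 0 r with h | h
    · left
      have := hconv hx1 hx2 (by linarith : 0 ≤ r / 2) (by linarith [hr.2] : 0 ≤ 1 - r / 2)
        (by ring)
      convert this using 1
      module
    · right
      have := hconv hx1 hx2 (by linarith [hr.1] : 0 ≤ 1 + r / 2) (by linarith : 0 ≤ - r / 2)
        (by ring)
      convert this using 1
      module

/-- Prefix balancing: if a symmetric convex body has Gaussian measure close to one, then a long
sequence of vectors of a fixed short length can be signed so that all its partial sums remain in
the body. -/
theorem exists_prefix_balancing_radius : ∃ h : ℝ, 0 < h ∧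
    ∀ (E : Type) [NormedAddCommGroup E] [InnerProductSpace ℝ E] [FiniteDimensional ℝ E]
      [MeasurableSpace E] [BorelSpace E] (K : Set E) (n : ℕ) (v : ℕ → E) (δ : ℝ), IsCompact K →
      Convex ℝ K → (∀ x ∈ K, -x ∈ K) → 1 - δ ≤ (stdGaussian E).real K → (n + 1) * δ ≤ 1 / 2 →
      (∀ i, ‖v i‖ = h) →
      ∃ ε : ℕ → ℝ, (∀ i, ε i = 1 ∨ ε i = -1) ∧ ∀ k ≤ n, ∑ i ∈ Finset.range k, ε i • v i ∈ K := by
  obtain ⟨h, h0, H⟩ := exists_balancing_radius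
  refine ⟨h, h0, fun E _ _ _ _ _ K n v δ hK hconv hsymm hγ hδ hv => ?_⟩
  have hδ0 : 0 ≤ δ := by
    have := measureReal_le_one (μ := stdGaussian E) (s := K)
    linarith
  have chain : ∃ S : Set E, IsCompact S ∧ Convex ℝ S ∧ (∀ x ∈ S, -x ∈ S) ∧
      1 - (n + 1) * δ ≤ (stdGaussian E).real S ∧ ∀ x ∈ S, ∃ ε : ℕ → ℝ,
        (∀ i, ε i = 1 ∨ ε i = -1) ∧ ∀ k ≤ n, x + ∑ i ∈ Finset.range k, ε i • v i ∈ K := by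
    induction n generalizing v with
    | zero =>
      refine ⟨K, hK, hconv, hsymm, by simpa using hγ, fun x hx => ⟨1, fun _ => .inl rfl, ?_⟩⟩
      intro k hk
      simpa [Nat.le_zero.1 hk] using hx
    | succ n ih =>
      push_cast at hδ ⊢
      obtain ⟨S, hS, hSconv, hSsymm, hSγ, hSv⟩ := ih (fun i => v (i + 1)) (by linarith)
        fun i => hv (i + 1)
      obtain ⟨T, hT, hTconv, hTsymm, hTγ, hTv⟩ := H E S (v 0) hS hSconv hSsymm (by linarith) (hv 0)
      refine ⟨K ∩ T, hK.inter hT, hconv.inter hTconv,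
        fun x hx => ⟨hsymm x hx.1, hTsymm x hx.2⟩, ?_, fun x hx => ?_⟩
      · have h1 := measureReal_union_add_inter (μ := stdGaussian E) (s := K) hT.measurableSet
        have h2 := measureReal_le_one (μ := stdGaussian E) (s := K ∪ T)
        linarith
      · have hsign : ∃ e : ℝ, (e = 1 ∨ e = -1) ∧ x + e • v 0 ∈ S := by
          rcases hTv x hx.2 with h | h
          · exact ⟨-1, .inr rfl, by simpa [sub_eq_add_neg] using h⟩
          · exact ⟨1, .inl rfl, by simpa using h⟩
        obtain ⟨e, he, hxe⟩ := hsign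
        obtain ⟨ε, hε, hsum⟩ := hSv _ hxe
        refine ⟨fun i => i.casesOn e ε, fun i => by cases i <;> simp [he, hε], fun k hk => ?_⟩
        cases k with
        | zero => simpa using hx.1
        | succ k =>
          rw [Finset.sum_range_succ', add_comm (Finset.sum _ _), ← add_assoc]
          exact hsum k (by omega)
  obtain ⟨S, -, hSconv, hSsymm, hSγ, hSv⟩ := chain
  have hne : S.Nonempty := by
    by_contra hne
    rw [not_nonempty_iff_eq_empty.1 hne, measureReal_empty] at hSγ
    linarith
  obtain ⟨x, hx⟩ := hne
  have hzero : (0 : E) ∈ S := by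
    have := hSconv hx (hSsymm x hx) (by norm_num : (0 : ℝ) ≤ 1 / 2)
      (by norm_num : (0 : ℝ) ≤ 1 / 2) (by norm_num)
    simpa using this
  obtain ⟨ε, hε, hsum⟩ := hSv 0 hzero
  exact ⟨ε, hε, fun k hk => by simpa using hsum k hk⟩

theorem stdGaussian_abs_inner_ge_le {E : Type*} [NormedAddCommGroup E]
    [InnerProductSpace ℝ E] [FiniteDimensional ℝ E] [MeasurableSpace E] [BorelSpace E] {b : E}
    {B r : ℝ} (hB : 0 < B) (hb : ‖b‖ ≤ B) (hr : 0 ≤ r) :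
    (stdGaussian E).real {x | B * r ≤ |inner ℝ b x|} ≤ 2 * Real.exp (-r ^ 2 / 2) := by
  let L : StrongDual ℝ E := innerSL ℝ b
  have hmap : (stdGaussian E).map L = gaussianReal 0 (‖b‖ ^ 2).toNNReal := by
    rw [IsGaussian.map_eq_gaussianReal, integral_strongDual_stdGaussian,
      variance_dual_stdGaussian, innerSL_apply_norm]
  have hsub : HasSubgaussianMGF L (B ^ 2).toNNReal (stdGaussian E) := by
    constructor
    · intro t
      have := integrable_exp_mul_gaussianReal (μ := 0) (v := (‖b‖ ^ 2).toNNReal) t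
      rw [← hmap, integrable_map_measure (by fun_prop) (by fun_prop)] at this
      exact this
    · intro t
      rw [mgf_gaussianReal hmap, zero_mul, zero_add]
      gcongr
  have hBr : 0 ≤ B * r := by positivity
  have e : -(B * r) ^ 2 / (2 * ((B ^ 2).toNNReal : ℝ)) = -r ^ 2 / 2 := by
    rw [Real.coe_toNNReal _ (by positivity)]
    field_simp
  have h1 := hsub.measure_ge_le hBr
  have h2 := hsub.neg.measure_ge_le hBr
  rw [e] at h1 h2
  calc _ ≤ (stdGaussian E).real ({x | B * r ≤ L x} ∪ {x | B * r ≤ (-L) x}) := by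
        refine measureReal_mono fun x hx => ?_
        exact le_abs.1 (show B * r ≤ |inner ℝ b x| from hx)
    _ ≤ _ := measureReal_union_le _ _
    _ ≤ Real.exp (-r ^ 2 / 2) + Real.exp (-r ^ 2 / 2) := add_le_add h1 h2
    _ = _ := by ring

theorem exists_closedBall_measureReal_ge {E : Type*} [NormedAddCommGroup E] [MeasurableSpace E]
    [BorelSpace E] [SecondCountableTopology E] [CompleteSpace E] (μ : Measure E)
    [IsProbabilityMeasure μ] {ε : ℝ} (hε : 0 < ε) :
    ∃ R, 1 - ε ≤ μ.real (Metric.closedBall 0 R) := by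
  obtain ⟨C, -, hC, hlt⟩ := MeasurableSet.univ.exists_isCompact_sdiff_lt (μ := μ)
    (measure_ne_top _ _) (ε := ENNReal.ofReal ε) (by simpa using hε)
  obtain ⟨R, hR⟩ := hC.isBounded.subset_closedBall 0
  refine ⟨R, ?_⟩
  have h1 : μ.real Cᶜ ≤ ε := by
    rw [← compl_eq_univ_sdiff] at hlt
    exact ENNReal.toReal_le_of_le_ofReal hε.le hlt.le
  rw [probReal_compl_eq_one_sub hC.measurableSet] at h1
  linarith [measureReal_mono (μ := μ) hR]

/-- Vector balancing against finitely many test vectors, uniformly over all prefixes. -/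
theorem exists_sign_forall_prefix_abs_inner_le : ∃ C : ℝ, 0 < C ∧
    ∀ (E : Type) [NormedAddCommGroup E] [InnerProductSpace ℝ E] [FiniteDimensional ℝ E]
      (J : Type) [Fintype J] (b : J → E) (B : ℝ) (n : ℕ) (v : ℕ → E) (s : ℝ), 0 < B →
      (∀ j, ‖b j‖ ≤ B) → 0 < s → (∀ i, ‖v i‖ = s) →
      ∃ ε : ℕ → ℝ, (∀ i, ε i = 1 ∨ ε i = -1) ∧ ∀ k ≤ n, ∀ j,
        |∑ i ∈ Finset.range k, ε i * inner ℝ (b j) (v i)| ≤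
          C * B * s * √(2 * Real.log (8 * (n + 1) * (Fintype.card J + 1))) := by
  obtain ⟨h, h0, H⟩ := exists_prefix_balancing_radius
  refine ⟨1 / h, by positivity, fun E _ _ _ J _ b B n v s hB hb hs hv => ?_⟩
  borelize E
  set r := √(2 * Real.log (8 * (n + 1) * (Fintype.card J + 1))) with hr
  have hr0 : 0 ≤ r := Real.sqrt_nonneg _
  have hrexp : Real.exp (-r ^ 2 / 2) = 1 / (8 * (n + 1) * (Fintype.card J + 1)) := by
    have : 0 ≤ Real.log (8 * (n + 1) * (Fintype.card J + 1)) := by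
      refine Real.log_nonneg ?_
      have h1 : (0 : ℝ) ≤ n := n.cast_nonneg
      have h2 : (0 : ℝ) ≤ Fintype.card J := Nat.cast_nonneg _
      nlinarith [mul_nonneg h1 h2]
    rw [hr, Real.sq_sqrt (by positivity), one_div, ← Real.exp_log (by positivity :
      (0 : ℝ) < 8 * (n + 1) * (Fintype.card J + 1)), ← Real.exp_neg, Real.exp_log (by positivity)]
    congr 1
    ring
  obtain ⟨R, hR⟩ := exists_closedBall_measureReal_ge (stdGaussian E)
    (by positivity : (0 : ℝ) < 1 / (4 * (n + 1)))
  let T : Set E := {x | ∀ j, |inner ℝ (b j) x| ≤ B * r}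
  have hT : IsClosed T := by
    simp only [T, ofPred_forall]
    exact isClosed_iInter fun j => isClosed_le (by fun_prop) continuous_const
  have hTconv : Convex ℝ T := by
    intro x hx y hy p q hp hq hpq j
    rw [inner_add_right, real_inner_smul_right, real_inner_smul_right]
    calc _ ≤ |p * inner ℝ (b j) x| + |q * inner ℝ (b j) y| := abs_add_le _ _
      _ = p * |inner ℝ (b j) x| + q * |inner ℝ (b j) y| := by
        rw [abs_mul, abs_mul, abs_of_nonneg hp, abs_of_nonneg hq]
      _ ≤ p * (B * r) + q * (B * r) := by gcongr <;> apply_assumption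
      _ = B * r := by rw [← add_mul, hpq, one_mul]
  have hTγ : (stdGaussian E).real Tᶜ ≤ 1 / (4 * (n + 1)) := by
    calc _ ≤ (stdGaussian E).real (⋃ j, {x | B * r ≤ |inner ℝ (b j) x|}) := by
          refine measureReal_mono fun x hx => ?_
          simp only [T, mem_compl_iff, mem_ofPred_eq, not_forall, not_le] at hx
          obtain ⟨j, hj⟩ := hx
          exact mem_iUnion.2 ⟨j, hj.le⟩
      _ ≤ ∑ j, (stdGaussian E).real {x | B * r ≤ |inner ℝ (b j) x|} :=
          measureReal_iUnion_fintype_le _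
      _ ≤ ∑ j : J, 2 * Real.exp (-r ^ 2 / 2) :=
          Finset.sum_le_sum fun j _ => stdGaussian_abs_inner_ge_le hB (hb j) hr0
      _ ≤ _ := by
          rw [Finset.sum_const, hrexp, Finset.card_univ, nsmul_eq_mul]
          have h1 : (0 : ℝ) ≤ n := n.cast_nonneg
          have h2 : (0 : ℝ) ≤ Fintype.card J := Nat.cast_nonneg _
          rw [mul_one_div, ← mul_div_assoc, div_le_div_iff₀ (by positivity) (by positivity)]
          nlinarith [mul_nonneg h1 h2]
  rw [probReal_compl_eq_one_sub hT.measurableSet] at hTγ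
  obtain ⟨ε, hε, hsum⟩ := H E (Metric.closedBall 0 R ∩ T) n (fun i => (h / s) • v i)
    (1 / (2 * (n + 1))) ((isCompact_closedBall _ _).inter_right hT)
    ((convex_closedBall _ _).inter hTconv) (fun x hx => ⟨by simpa using hx.1, fun j => by
      rw [inner_neg_right, abs_neg]; exact hx.2 j⟩) (by
      have h1 := measureReal_union_add_inter (μ := stdGaussian E) (s := Metric.closedBall 0 R)
        hT.measurableSet
      have h2 := measureReal_le_one (μ := stdGaussian E) (s := Metric.closedBall 0 R ∪ T)
      have h3 : (1 : ℝ) / (2 * (n + 1)) = 1 / (4 * (n + 1)) + 1 / (4 * (n + 1)) := by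
        field_simp
        norm_num
      linarith) (by field_simp; rfl) (fun i => by
      rw [norm_smul, hv, Real.norm_of_nonneg (by positivity), div_mul_cancel₀ _ hs.ne'])
  refine ⟨ε, hε, fun k hk j => ?_⟩
  have hkj := (hsum k hk).2 j
  have e : ∑ i ∈ Finset.range k, ε i * inner ℝ (b j) (v i) =
      s / h * inner ℝ (b j) (∑ i ∈ Finset.range k, ε i • (h / s) • v i) := by
    simp only [inner_sum, real_inner_smul_right, Finset.mul_sum]
    refine Finset.sum_congr rfl fun i _ => ?_
    field_simp
  rw [e, abs_mul, abs_of_pos (by positivity)]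
  calc _ ≤ s / h * (B * r) := by gcongr
    _ = _ := by ring

/-- The indicator of the dyadic cells of `ℕ` containing `r`, indexed by level and position. -/
noncomputable def dyadicCell {L N : ℕ} (r : ℕ) (c : Fin L × Fin (N + 1)) : ℝ :=
  if r / 2 ^ (c.1 : ℕ) = c.2 then 1 else 0

/-- The indicator of the dyadic cells in the canonical decomposition of the interval `[0, T)`. -/
noncomputable def dyadicInterval {L N : ℕ} (T : ℕ) (c : Fin L × Fin (N + 1)) : ℝ :=
  if T / 2 ^ (c.1 : ℕ) % 2 = 1 ∧ (c.2 : ℕ) + 1 = T / 2 ^ (c.1 : ℕ) then 1 else 0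

theorem sum_dyadicCell_mul_self {L N r : ℕ} (hr : r ≤ N) :
    ∑ c : Fin L × Fin (N + 1), dyadicCell r c * dyadicCell r c = L := by
  rw [Fintype.sum_prod_type]
  have : ∀ j : Fin L, ∑ q : Fin (N + 1), dyadicCell r (j, q) * dyadicCell r (j, q) = 1 := by
    intro j
    have hlt : r / 2 ^ (j : ℕ) < N + 1 := (Nat.div_le_self _ _).trans_lt (by omega)
    rw [Finset.sum_eq_single ⟨r / 2 ^ (j : ℕ), hlt⟩]
    · simp [dyadicCell]
    · intro q _ hq
      have : r / 2 ^ (j : ℕ) ≠ q := fun h => hq (Fin.ext h.symm)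
      simp [dyadicCell, this]
    · simp
  simp [this]

theorem sum_dyadicInterval_mul_self_le (L N T : ℕ) :
    ∑ c : Fin L × Fin (N + 1), dyadicInterval T c * dyadicInterval T c ≤ L := by
  rw [Fintype.sum_prod_type]
  have : ∀ j : Fin L, ∑ q : Fin (N + 1), dyadicInterval T (j, q) * dyadicInterval T (j, q) ≤ 1 := by
    intro j
    have h1 : ∀ q : Fin (N + 1), dyadicInterval T (j, q) * dyadicInterval T (j, q) =
        if T / 2 ^ (j : ℕ) % 2 = 1 ∧ (q : ℕ) + 1 = T / 2 ^ (j : ℕ) then 1 else 0 := by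
      intro q
      simp only [dyadicInterval]
      split_ifs <;> simp
    simp only [h1, Finset.sum_boole]
    have h2 : (Finset.univ.filter fun q : Fin (N + 1) =>
        T / 2 ^ (j : ℕ) % 2 = 1 ∧ (q : ℕ) + 1 = T / 2 ^ (j : ℕ)).card ≤ 1 := by
      refine Finset.card_le_one.2 fun x hx y hy => Fin.ext ?_
      simp only [Finset.mem_filter] at hx hy
      omega
    exact_mod_cast h2
  calc _ ≤ ∑ _j : Fin L, (1 : ℝ) := Finset.sum_le_sum fun j _ => this j
    _ = L := by simp

theorem sum_range_dyadic {L : ℕ} {r T : ℕ} (hT : T < 2 ^ L) :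
    ∑ j ∈ Finset.range L,
      (if T / 2 ^ j % 2 = 1 ∧ r / 2 ^ j + 1 = T / 2 ^ j then (1 : ℝ) else 0) =
      if r < T then 1 else 0 := by
  induction L generalizing r T with
  | zero =>
    have : T = 0 := by simpa using hT
    simp [this]
  | succ L ih =>
    rw [Finset.sum_range_succ']
    simp only [pow_succ', ← Nat.div_div_eq_div_mul]
    rw [ih (by rw [pow_succ] at hT; omega)]
    simp only [pow_zero, Nat.div_one]
    split_ifs <;> first | omega | simp

theorem sum_dyadicInterval_mul_dyadicCell {L N r T : ℕ} (hr : r ≤ N) (hT : T < 2 ^ L) :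
    ∑ c : Fin L × Fin (N + 1), dyadicInterval T c * dyadicCell r c = if r < T then 1 else 0 := by
  rw [Fintype.sum_prod_type, ← sum_range_dyadic hT, Finset.sum_range]
  refine Finset.sum_congr rfl fun j _ => ?_
  have hlt : r / 2 ^ (j : ℕ) < N + 1 := (Nat.div_le_self _ _).trans_lt (by omega)
  rw [Finset.sum_eq_single ⟨r / 2 ^ (j : ℕ), hlt⟩]
  · simp [dyadicCell, dyadicInterval]
  · intro q _ hq
    have : r / 2 ^ (j : ℕ) ≠ q := fun h => hq (Fin.ext h.symm)
    simp [dyadicCell, this]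
  · simp

theorem inner_toLp_prod {m : ℕ} {κ : Type*} [Fintype κ] (f g : Fin m → κ → ℝ) :
    inner ℝ (WithLp.toLp 2 fun c : Fin m → κ => ∏ i, f i (c i))
      (WithLp.toLp 2 fun c : Fin m → κ => ∏ i, g i (c i)) = ∏ i, ∑ c, f i c * g i c := by
  classical
  rw [Finset.prod_univ_sum, Fintype.piFinset_univ]
  simp [PiLp.inner_apply, Finset.prod_mul_distrib, mul_comm]

theorem exists_sign_forall_prefix_grid_le : ∃ C : ℝ, 0 < C ∧
    ∀ (m N L : ℕ) (ρ : ℕ → Fin m → ℕ), 0 < L → N < 2 ^ L → (∀ i l, ρ i l ≤ N) →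
      ∃ ε : ℕ → ℝ, (∀ i, ε i = 1 ∨ ε i = -1) ∧ ∀ k ≤ N, ∀ T : Fin m → ℕ, (∀ l, T l ≤ N) →
        |∑ i ∈ Finset.range k, ε i * ∏ l, if ρ i l < T l then 1 else 0| ≤
          C * L ^ m * √(2 * Real.log (8 * (N + 1) * ((N + 1) ^ m + 1))) := by
  obtain ⟨C, hC, H⟩ := exists_sign_forall_prefix_abs_inner_le
  refine ⟨C, hC, fun m N L ρ hL hN hρ => ?_⟩
  have hL' : (0 : ℝ) < L := by exact_mod_cast hL
  obtain ⟨ε, hε, hsum⟩ := H (EuclideanSpace ℝ (Fin m → Fin L × Fin (N + 1)))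
    (Fin m → Fin (N + 1))
    (fun T => WithLp.toLp 2 fun c => ∏ l, dyadicInterval (T l) (c l)) √(L ^ m) N
    (fun i => WithLp.toLp 2 fun c => ∏ l, dyadicCell (ρ i l) (c l)) √(L ^ m) (by positivity)
    (fun T => by
      refine Real.le_sqrt_of_sq_le ?_
      rw [← real_inner_self_eq_norm_sq, inner_toLp_prod (fun l => dyadicInterval (T l))]
      calc _ ≤ ∏ _l : Fin m, (L : ℝ) := Finset.prod_le_prod
            (fun l _ => Finset.sum_nonneg fun c _ => mul_self_nonneg _)
            fun l _ => sum_dyadicInterval_mul_self_le _ _ _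
        _ = _ := by simp) (by positivity)
    (fun i => by
      rw [← Real.sqrt_sq (norm_nonneg _), ← real_inner_self_eq_norm_sq,
        inner_toLp_prod (fun l => dyadicCell (ρ i l))]
      simp [sum_dyadicCell_mul_self (hρ i _)])
  refine ⟨ε, hε, fun k hk T hT => ?_⟩
  have := hsum k hk fun l => ⟨T l, Nat.lt_succ_of_le (hT l)⟩
  rw [mul_assoc C, Real.mul_self_sqrt (by positivity)] at this
  simp only [inner_toLp_prod (fun l => dyadicInterval (T l)),
    sum_dyadicInterval_mul_dyadicCell (hρ _ _) ((hT _).trans_lt hN)] at this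
  simpa using this

theorem exists_forall_le_iff_lt_of_monotone {N : ℕ} {f : Fin N → ℝ} (hf : Monotone f) (t : ℝ) :
    ∃ k ≤ N, ∀ i : Fin N, f i ≤ t ↔ (i : ℕ) < k := by
  classical
  have h : ∃ k, ∀ i : Fin N, k ≤ (i : ℕ) → t < f i := ⟨N, fun i hi => absurd i.2 (not_lt.2 hi)⟩
  refine ⟨Nat.find h, Nat.find_min' h fun i hi => absurd i.2 (not_lt.2 hi), fun i => ⟨?_, ?_⟩⟩
  · intro hi
    by_contra hle
    exact (Nat.find_spec h i (not_lt.1 hle)).not_ge hi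
  · intro hi
    have := Nat.find_min h hi
    push Not at this
    obtain ⟨j, hij, hj⟩ := this
    exact (hf (Fin.le_def.2 hij)).trans hj

theorem le_iff_card_filter_lt_card_filter {α : Type*} {P : Finset α} (f : α → ℝ) {p : α}
    (hp : p ∈ P) (t : ℝ) :
    f p ≤ t ↔ (P.filter fun q => f q < f p).card < (P.filter fun q => f q ≤ t).card := by
  constructor
  · intro h
    refine Finset.card_lt_card (Finset.ssubset_iff_of_subset ?_ |>.2 ⟨p, ?_, ?_⟩)
    · exact fun q hq => by
        rw [Finset.mem_filter] at hq ⊢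
        exact ⟨hq.1, hq.2.le.trans h⟩
    · simp [hp, h]
    · simp
  · intro h
    by_contra hlt
    refine h.not_ge (Finset.card_le_card fun q hq => ?_)
    rw [Finset.mem_filter] at hq ⊢
    exact ⟨hq.1, hq.2.trans_lt (not_le.1 hlt)⟩

theorem exists_equiv_monotone {α : Type*} {N : ℕ} {P : Finset α} (hP : P.card = N) (f : α → ℝ) :
    ∃ g : Fin N ≃ P, Monotone fun i => f (g i) :=
  let e := (P.equivFinOfCardEq hP).symm
  ⟨(Tuple.sort fun i => f (e i)).trans e, Tuple.monotone_sort fun i => f (e i)⟩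

/-- Every finite point set in the unit cube of dimension `m + 1` can be coloured so that its
discrepancy with respect to anchored boxes is polylogarithmic. -/
theorem exists_coloring_abs_sum_indicator_le : ∃ C : ℝ, 0 < C ∧
    ∀ (m N L : ℕ) (P : Finset (Fin (m + 1) → ℝ)), 0 < L → N < 2 ^ L → P.card = N →
      (P : Set (Fin (m + 1) → ℝ)) ⊆ Icc 0 1 →
      ∃ y : (Fin (m + 1) → ℝ) → ℝ, (∀ p ∈ P, y p = 1 ∨ y p = -1) ∧
        ∀ a : Fin (m + 1) → ℝ, |∑ p ∈ P, (Icc 0 a).indicator y p| ≤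
          C * L ^ m * √(2 * Real.log (8 * (N + 1) * ((N + 1) ^ m + 1))) := by
  classical
  obtain ⟨C, hC, H⟩ := exists_sign_forall_prefix_grid_le
  refine ⟨C, hC, fun m N L P hL hN hcard hP => ?_⟩
  obtain ⟨g, hg⟩ := exists_equiv_monotone hcard fun p => p 0
  have filter_le : ∀ (s : (Fin (m + 1) → ℝ) → Prop) [DecidablePred s],
      (P.filter s).card ≤ N := fun s _ => (Finset.card_filter_le _ _).trans hcard.le
  obtain ⟨ε, hε, hsum⟩ := H m N L
    (fun i l => if h : i < N then
      (P.filter fun q => q l.succ < (g ⟨i, h⟩ : Fin (m + 1) → ℝ) l.succ).card else 0) hL hN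
    (fun i l => by
      split_ifs
      · exact filter_le _
      · exact N.zero_le)
  refine ⟨fun p => if h : p ∈ P then ε (g.symm ⟨p, h⟩) else 0, fun p hp => ?_, fun a => ?_⟩
  · simp only [hp, dif_pos]
    exact hε _
  obtain ⟨k, hk, hka⟩ := exists_forall_le_iff_lt_of_monotone hg (a 0)
  convert hsum k hk (fun l => (P.filter fun q => q l.succ ≤ a l.succ).card)
    (fun l => filter_le _) using 2
  have e : Finset.range k = (Finset.range N).filter (· < k) := by
    ext i
    simp only [Finset.mem_range, Finset.mem_filter]
    omega
  rw [e, Finset.sum_filter, Finset.sum_range, ← Finset.sum_coe_sort P, ← g.sum_comp]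
  refine Finset.sum_congr rfl fun i _ => ?_
  have hnonneg : (0 : Fin (m + 1) → ℝ) ≤ g i := (hP (g i).2).1
  have hrank : ∀ l : Fin m, ((P.filter fun q => q l.succ < (g i : Fin (m + 1) → ℝ) l.succ).card <
      (P.filter fun q => q l.succ ≤ a l.succ).card) ↔ (g i : Fin (m + 1) → ℝ) l.succ ≤ a l.succ :=
    fun l => (le_iff_card_filter_lt_card_filter (fun q => q l.succ) (g i).2 _).symm
  have hmem : (g i : Fin (m + 1) → ℝ) ∈ Icc 0 a ↔ (i : ℕ) < k ∧
      ∀ l : Fin m, (g i : Fin (m + 1) → ℝ) l.succ ≤ a l.succ := by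
    rw [← hka i, mem_Icc, and_iff_right hnonneg, Pi.le_def, Fin.forall_fin_succ]
  simp only [indicator_apply, hmem, i.2, dif_pos, Fin.eta, hrank, (g i).2, Subtype.coe_eta,
    Equiv.symm_apply_apply, Finset.prod_boole, Finset.mem_univ, true_imp_iff, mul_ite, mul_one,
    mul_zero, ite_and]

end

/-- Upper bound for Tusnády's problem: for every `d ≥ 1` there is a constant `c_d > 0`
such that every set `P` of `N ≥ 2` points in `[0,1]^d` admits a red-blue coloring
`y : P → {−1,+1}` whose discrepancy with respect to anchored axis-parallel boxes is at
most `c_d (log N)^(d - 1/2)`. -/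
theorem tusnady_coloring_bound (d : ℕ) (hd : 1 ≤ d) :
    ∃ c : ℝ, 0 < c ∧
      ∀ N : ℕ, 2 ≤ N →
        ∀ P : Finset (Fin d → ℝ), P.card = N →
          ↑P ⊆ Set.Icc (0 : Fin d → ℝ) 1 →
          ∃ y : (Fin d → ℝ) → ℝ,
            (∀ p ∈ P, y p = 1 ∨ y p = -1) ∧
            ∀ a : Fin d → ℝ, a ∈ Set.Icc (0 : Fin d → ℝ) 1 →
              |∑ p ∈ P, (Set.Icc (0 : Fin d → ℝ) a).indicator y p|
                ≤ c * Real.log N ^ ((d : ℝ) - 1 / 2) := by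
  obtain ⟨m, rfl⟩ := Nat.exists_eq_add_of_le' hd
  obtain ⟨C, hC, H⟩ := exists_coloring_abs_sum_indicator_le
  refine ⟨C * 3 ^ m * √(2 * (2 * m + 6 : ℕ)), by positivity, fun N hN P hcard hP => ?_⟩
  obtain ⟨y, hy, hsum⟩ := H m N (Nat.log 2 N + 1) P (Nat.succ_pos _)
    (Nat.lt_pow_succ_log_self one_lt_two N) hcard hP
  refine ⟨y, hy, fun a _ => (hsum a).trans ?_⟩
  have hN' : (2 : ℝ) ≤ N := by exact_mod_cast hN
  have hlog : 0 < Real.log N := Real.log_pos (by linarith)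
  have hL : ((Nat.log 2 N + 1 : ℕ) : ℝ) ≤ 3 * Real.log N := by
    have h1 : Real.log (2 ^ Nat.log 2 N) ≤ Real.log N := by
      refine Real.log_le_log (by positivity) ?_
      exact_mod_cast Nat.pow_log_le_self 2 (by omega)
    have h2 : Real.log 2 ≤ Real.log N := Real.log_le_log (by norm_num) hN'
    rw [Real.log_pow] at h1
    have h3 := Real.log_two_gt_d9
    have h4 : (0 : ℝ) ≤ Nat.log 2 N := Nat.cast_nonneg _
    push_cast
    nlinarith
  have hpoly : Real.log (8 * (N + 1) * ((N + 1) ^ m + 1)) ≤ (2 * m + 6 : ℕ) * Real.log N := by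
    rw [← Real.log_pow]
    refine Real.log_le_log (by positivity) ?_
    have h1 : (8 : ℝ) ≤ N ^ 3 := by
      calc (8 : ℝ) = 2 ^ 3 := by norm_num
        _ ≤ N ^ 3 := by gcongr
    have h2 : (N + 1 : ℝ) ≤ N ^ 2 := by nlinarith
    have h3 : (N + 1 : ℝ) ^ m + 1 ≤ N * (N ^ 2) ^ m := by
      have h4 : (N + 1 : ℝ) ^ m ≤ (N ^ 2) ^ m := by gcongr
      have h5 : (1 : ℝ) ≤ (N ^ 2) ^ m := one_le_pow₀ (by nlinarith)
      nlinarith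
    calc _ ≤ (N : ℝ) ^ 3 * N ^ 2 * (N * (N ^ 2) ^ m) := by gcongr
      _ = _ := by ring
  calc _ ≤ C * (3 * Real.log N) ^ m * √(2 * ((2 * m + 6 : ℕ) * Real.log N)) := by gcongr
    _ = C * 3 ^ m * √(2 * (2 * m + 6 : ℕ)) * (Real.log N ^ m * √(Real.log N)) := by
      rw [← mul_assoc 2, Real.sqrt_mul (by positivity), mul_pow]
      ring
    _ = _ := by
      rw [show ((m + 1 : ℕ) : ℝ) - 1 / 2 = m + 1 / 2 by push_cast; ring, Real.rpow_add hlog,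
        Real.rpow_natCast, ← Real.sqrt_eq_rpow]
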